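/- Homogenization and Macaulay H-bases: let v_1, …, v_s ∈ T^{⊕n} be nonzero and let M ⊆ T^{⊕n} be the T-submodule they generate. Then the following are equivalent: (1) the R-submodule M^H of N generated by { m^H : m ∈ M, m ≠ 0 } is generated by v_1^H, …, v_s^H; (2) v_1, …, v_s is a Macaulay H-basis of M, i.e. the T-submodule of T^{⊕n} generated by the leading forms (with respect to the shifted ℕ-grading) of all nonzero elements of M is generated by the leading forms of v_1, …, v_s. -/

import Mathlib

/-
Homogenization: `T = 𝕜[x_1, …, x_d]`, `R = 𝕜[x_1, …, x_d, t]` (realized as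
`MvPolynomial (Fin (d+1)) 𝕜` with `t` the last variable), both graded by total degree,
and `T^{⊕n}`, `N = R^{⊕n}` graded with shifts `a : Fin n → ℕ`.
-/

open scoped Classical

noncomputable section

variable {𝕜 : Type*} [Field 𝕜] {d n : ℕ}

/-- Homogenization `p^h := t^{deg p} · p(x₁/t, …, x_d/t)` of a polynomial, where `t` is
the last variable of `𝕜[x₁, …, x_d, t]`. -/
def homogPoly (p : MvPolynomial (Fin d) 𝕜) : MvPolynomial (Fin (d + 1)) 𝕜 :=
  ∑ α ∈ p.support,
    MvPolynomial.monomial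
      (Finsupp.mapDomain Fin.castSucc α +
        Finsupp.single (Fin.last d) (p.totalDegree - α.sum fun _ e => e))
      (MvPolynomial.coeff α p)

/-- The degree of a nonzero vector `m ∈ T^{⊕n}` with respect to the shifted grading:
`deg m = max { a i + deg (m i) : m i ≠ 0 }`. -/
def vdeg (a : Fin n → ℕ) (m : Fin n → MvPolynomial (Fin d) 𝕜) : ℕ :=
  Finset.univ.sup fun i => if m i = 0 then 0 else a i + (m i).totalDegree

/-- The homogenization `m^H` of a vector `m ∈ T^{⊕n}` with respect to the grading of
`N = ⨁ i, R(-a i)`: the `i`-th component is `t^{deg m - a i - deg (m i)} · (m i)^h`. -/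
def homogVec (a : Fin n → ℕ) (m : Fin n → MvPolynomial (Fin d) 𝕜) :
    Fin n → MvPolynomial (Fin (d + 1)) 𝕜 := fun i =>
  if m i = 0 then 0 else
    MvPolynomial.X (Fin.last d) ^ (vdeg a m - a i - (m i).totalDegree) * homogPoly (m i)

/-- The leading form of `m ∈ T^{⊕n}` with respect to the shifted grading: its
homogeneous component in degree `deg m`, whose `i`-th entry is the homogeneous component
of `m i` of degree `deg m - a i`. -/
def lfVec (a : Fin n → ℕ) (m : Fin n → MvPolynomial (Fin d) 𝕜) :
    Fin n → MvPolynomial (Fin d) 𝕜 := fun i =>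
  MvPolynomial.homogeneousComponent (vdeg a m - a i) (m i)

open MvPolynomial in
/-- The `𝕜`-linear map sending a monomial `x^α` to `x^α * t^(e - |α|)`, with truncated
subtraction. On polynomials of degree at most `e` this is homogenization in degree `e`. -/
def homogAt (e : ℕ) : MvPolynomial (Fin d) 𝕜 →ₗ[𝕜] MvPolynomial (Fin (d + 1)) 𝕜 :=
  (basisMonomials (Fin d) 𝕜).constr 𝕜 fun α =>
    monomial (Finsupp.mapDomain Fin.castSucc α + Finsupp.single (Fin.last d) (e - α.degree)) 1

/-- Homogenization of a vector in degree `k` with respect to the shifted grading. -/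
def homogVecAt (a : Fin n → ℕ) (k : ℕ) :
    (Fin n → MvPolynomial (Fin d) 𝕜) →ₗ[𝕜] (Fin n → MvPolynomial (Fin (d + 1)) 𝕜) :=
  LinearMap.pi fun i => homogAt (k - a i) ∘ₗ LinearMap.proj i

/-- The substitution `t = 0`. -/
def evalLastZero : MvPolynomial (Fin (d + 1)) 𝕜 →ₐ[𝕜] MvPolynomial (Fin d) 𝕜 :=
  MvPolynomial.aeval (Fin.snoc (α := fun _ => MvPolynomial (Fin d) 𝕜) MvPolynomial.X 0)

open MvPolynomial in
theorem homogAt_monomial (e : ℕ) (α : Fin d →₀ ℕ) (r : 𝕜) :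
    homogAt e (monomial α r) =
      monomial (Finsupp.mapDomain Fin.castSucc α +
        Finsupp.single (Fin.last d) (e - α.degree)) r := by
  have h : monomial α r = r • basisMonomials (Fin d) 𝕜 α := by
    simp [smul_monomial]
  rw [h, map_smul, homogAt, Module.Basis.constr_basis, smul_monomial, smul_eq_mul, mul_one]

open MvPolynomial in
theorem homogAt_eq_sum (e : ℕ) (p : MvPolynomial (Fin d) 𝕜) :
    homogAt e p = ∑ α ∈ p.support,
      monomial (Finsupp.mapDomain Fin.castSucc α +
        Finsupp.single (Fin.last d) (e - α.degree)) (coeff α p) := by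
  conv_lhs => rw [p.as_sum, map_sum]
  simp only [homogAt_monomial]

open MvPolynomial in
theorem X_pow_mul_homogAt {e k : ℕ} {p : MvPolynomial (Fin d) 𝕜} (hp : p.totalDegree ≤ e) :
    X (Fin.last d) ^ k * homogAt e p = homogAt (e + k) p := by
  rw [homogAt_eq_sum, homogAt_eq_sum, Finset.mul_sum]
  refine Finset.sum_congr rfl fun α hα => ?_
  have hle : α.degree ≤ e := (le_totalDegree hα).trans hp
  rw [X_pow_eq_monomial, monomial_mul, one_mul, add_left_comm, ← Finsupp.single_add,
    ← Nat.add_sub_assoc hle, add_comm k e]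

theorem homogPoly_eq_homogAt (p : MvPolynomial (Fin d) 𝕜) :
    homogPoly p = homogAt p.totalDegree p :=
  (homogAt_eq_sum _ _).symm

open MvPolynomial in
theorem homogAt_mul {e : ℕ} {c : MvPolynomial (Fin d) 𝕜} (hc : c.IsHomogeneous e) (k : ℕ)
    (p : MvPolynomial (Fin d) 𝕜) :
    homogAt k (c * p) = rename Fin.castSucc c * homogAt (k - e) p := by
  rw [homogAt_eq_sum (k - e)]
  conv_lhs => rw [c.as_sum, p.as_sum, Finset.sum_mul_sum]
  conv_rhs => rw [c.as_sum, map_sum, Finset.sum_mul_sum]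
  simp only [map_sum]
  refine Finset.sum_congr rfl fun α hα => Finset.sum_congr rfl fun β _ => ?_
  have hdeg : α.degree = e := by
    rw [Finsupp.degree_eq_weight_one]
    exact hc (mem_support_iff.mp hα)
  rw [monomial_mul, homogAt_monomial, rename_monomial, monomial_mul, Finsupp.mapDomain_add,
    map_add, hdeg, Nat.sub_sub, add_assoc]

open MvPolynomial in
theorem evalLastZero_rename (c : MvPolynomial (Fin d) 𝕜) :
    evalLastZero (rename Fin.castSucc c) = c := by
  have h : (Fin.snoc (α := fun _ => MvPolynomial (Fin d) 𝕜) X 0) ∘ Fin.castSucc = X := by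
    funext i
    simp
  rw [evalLastZero, aeval_rename, h, aeval_X_left_apply]

open MvPolynomial in
theorem coeff_evalLastZero_homogAt (e : ℕ) (p : MvPolynomial (Fin d) 𝕜) (α : Fin d →₀ ℕ) :
    coeff α (evalLastZero (homogAt e p)) = if e ≤ α.degree then coeff α p else 0 := by
  induction p using MvPolynomial.induction_on' with
  | monomial β r =>
    have h : evalLastZero (homogAt e (monomial β r)) =
        monomial β r * (0 : MvPolynomial (Fin d) 𝕜) ^ (e - β.degree) := by
      rw [homogAt_monomial, ← mul_one r, ← monomial_mul, map_mul, ← rename_monomial,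
        evalLastZero_rename, ← X_pow_eq_monomial, map_pow, mul_one]
      simp [evalLastZero]
    rw [h]
    by_cases hβ : e ≤ β.degree
    · rw [Nat.sub_eq_zero_of_le hβ, pow_zero, mul_one, coeff_monomial]
      split_ifs with hαβ hα
      · rfl
      · exact absurd (hαβ ▸ hβ) hα
      · rfl
      · rfl
    · rw [zero_pow (by omega), mul_zero, coeff_zero, coeff_monomial]
      split_ifs with hα hαβ
      · exact absurd (hαβ ▸ hα) hβ
      · rfl
      · rfl
  | add p q hp hq =>
    rw [map_add, map_add, coeff_add, hp, hq, coeff_add]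
    split_ifs <;> simp

theorem add_totalDegree_le_vdeg (a : Fin n → ℕ) {m : Fin n → MvPolynomial (Fin d) 𝕜} {i : Fin n}
    (hi : m i ≠ 0) : a i + (m i).totalDegree ≤ vdeg a m := by
  have h := Finset.le_sup (f := fun i => if m i = 0 then 0 else a i + (m i).totalDegree)
    (Finset.mem_univ i)
  exact (if_neg hi).ge.trans h

theorem homogVecAt_apply (a : Fin n → ℕ) (k : ℕ) (m : Fin n → MvPolynomial (Fin d) 𝕜)
    (i : Fin n) : homogVecAt a k m i = homogAt (k - a i) (m i) :=
  rfl

open MvPolynomial in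
theorem X_pow_smul_homogVec (a : Fin n → ℕ) (m : Fin n → MvPolynomial (Fin d) 𝕜) {k : ℕ}
    (hk : vdeg a m ≤ k) :
    (X (Fin.last d) ^ (k - vdeg a m) : MvPolynomial (Fin (d + 1)) 𝕜) • homogVec a m =
      homogVecAt a k m := by
  funext i
  rw [Pi.smul_apply, smul_eq_mul, homogVecAt_apply, homogVec]
  split_ifs with hi
  · rw [hi, map_zero, mul_zero]
  · have h := add_totalDegree_le_vdeg a hi
    rw [homogPoly_eq_homogAt, X_pow_mul_homogAt le_rfl, X_pow_mul_homogAt (by omega)]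
    congr 2
    omega

theorem homogVec_eq_homogVecAt (a : Fin n → ℕ) (m : Fin n → MvPolynomial (Fin d) 𝕜) :
    homogVec a m = homogVecAt a (vdeg a m) m := by
  simpa using X_pow_smul_homogVec a m le_rfl

open MvPolynomial in
theorem homogVecAt_smul (a : Fin n → ℕ) {e : ℕ} {c : MvPolynomial (Fin d) 𝕜}
    (hc : c.IsHomogeneous e) (k : ℕ) (m : Fin n → MvPolynomial (Fin d) 𝕜) :
    homogVecAt a k (c • m) = rename Fin.castSucc c • homogVecAt a (k - e) m := by
  funext i
  rw [Pi.smul_apply, homogVecAt_apply, homogVecAt_apply, Pi.smul_apply, smul_eq_mul, smul_eq_mul,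
    homogAt_mul hc, Nat.sub_right_comm]

open MvPolynomial in
theorem evalLastZero_homogVec (a : Fin n → ℕ) (m : Fin n → MvPolynomial (Fin d) 𝕜) (i : Fin n) :
    evalLastZero (homogVec a m i) = lfVec a m i := by
  ext α
  rw [homogVec_eq_homogVecAt, homogVecAt_apply, coeff_evalLastZero_homogAt, lfVec,
    coeff_homogeneousComponent]
  by_cases hα : coeff α (m i) = 0
  · simp [hα]
  · have hi : m i ≠ 0 := fun h => hα (by rw [h, coeff_zero])
    have h := add_totalDegree_le_vdeg a hi
    have h' : α.degree ≤ (m i).totalDegree := le_totalDegree (mem_support_iff.mpr hα)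
    exact if_congr (by omega) rfl rfl

open MvPolynomial in
/-- If the degree-`k` homogenization of `m` vanishes at `t = 0`, then `m` has degree below `k`. -/
theorem vdeg_lt_of_evalLastZero_homogVecAt_eq_zero (a : Fin n → ℕ) {k : ℕ}
    {m : Fin n → MvPolynomial (Fin d) 𝕜} (hm : m ≠ 0)
    (h : ∀ i, evalLastZero (homogVecAt a k m i) = 0) : vdeg a m < k := by
  have key : ∀ i, m i ≠ 0 → a i + (m i).totalDegree < k := by
    intro i hi
    obtain ⟨α, hα, hdeg⟩ := Finset.exists_mem_eq_sup (m i).support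
      (support_nonempty.mpr hi) Finsupp.degree
    have hdeg' : (m i).totalDegree = α.degree := hdeg
    have hc := congrArg (coeff α) (h i)
    rw [homogVecAt_apply, coeff_evalLastZero_homogAt, coeff_zero] at hc
    by_contra hlt
    rw [if_pos (by omega)] at hc
    exact mem_support_iff.mp hα hc
  obtain ⟨i₀, hi₀⟩ := Function.ne_iff.mp hm
  have hk : 0 < k := (Nat.zero_le _).trans_lt (key i₀ hi₀)
  refine (Finset.sup_lt_iff hk).mpr fun i _ => ?_
  split_ifs with hi
  · exact hk
  · exact key i hi

open MvPolynomial in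
theorem homogeneousComponent_mul_of_isHomogeneous {q : ℕ} {h : MvPolynomial (Fin d) 𝕜}
    (hh : h.IsHomogeneous q) (k : ℕ) (c : MvPolynomial (Fin d) 𝕜) :
    homogeneousComponent k (c * h) =
      if q ≤ k then homogeneousComponent (k - q) c * h else 0 := by
  induction c using MvPolynomial.induction_on' with
  | monomial β r =>
    have hβ : (monomial β r : MvPolynomial (Fin d) 𝕜).IsHomogeneous β.degree :=
      isHomogeneous_monomial r rfl
    rw [homogeneousComponent_of_mem (hβ.mul hh), homogeneousComponent_of_mem hβ, ite_mul,
      zero_mul, ← ite_and]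
    exact if_congr (by omega) rfl rfl
  | add c₁ c₂ h₁ h₂ =>
    rw [add_mul, map_add, h₁, h₂, map_add, add_mul]
    split_ifs
    · rfl
    · rw [add_zero]

open MvPolynomial in
/-- A representation of a leading form by leading forms can be chosen homogeneous. -/
theorem exists_homogeneous_coeff_of_lfVec_eq_sum {ι : Type*} [Fintype ι] (a : Fin n → ℕ)
    {m : Fin n → MvPolynomial (Fin d) 𝕜} {v : ι → Fin n → MvPolynomial (Fin d) 𝕜}
    {c : ι → MvPolynomial (Fin d) 𝕜} (hc : ∑ j, c j • lfVec a (v j) = lfVec a m) :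
    ∃ b : ι → MvPolynomial (Fin d) 𝕜,
      (∀ j, (b j).IsHomogeneous (vdeg a m - vdeg a (v j))) ∧
      (∀ j, vdeg a m < vdeg a (v j) → b j = 0) ∧
      ∑ j, b j • lfVec a (v j) = lfVec a m := by
  refine ⟨fun j => if vdeg a (v j) ≤ vdeg a m then
    homogeneousComponent (vdeg a m - vdeg a (v j)) (c j) else 0, fun j => ?_, fun j hj => ?_, ?_⟩
  · dsimp only
    split_ifs
    · exact homogeneousComponent_isHomogeneous _ _
    · exact isHomogeneous_zero _ _ _
  · exact if_neg (by omega)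
  · have hzero : ∀ w : Fin n → MvPolynomial (Fin d) 𝕜, ∀ i, vdeg a w < a i → lfVec a w i = 0 := by
      intro w i hlt
      have hw : w i = 0 := by
        by_contra hne
        have := add_totalDegree_le_vdeg a hne
        omega
      rw [lfVec, hw, map_zero]
    funext i
    rw [Finset.sum_apply]
    by_cases hi : vdeg a m < a i
    · rw [hzero m i hi]
      refine Finset.sum_eq_zero fun j _ => ?_
      rw [Pi.smul_apply, smul_eq_mul]
      dsimp only
      split_ifs with hj
      · rw [hzero (v j) i (by omega), mul_zero]
      · rw [zero_mul]
    · have hm : homogeneousComponent (vdeg a m - a i) (lfVec a m i) = lfVec a m i :=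
        (homogeneousComponent_of_mem (homogeneousComponent_isHomogeneous _ _)).trans (if_pos rfl)
      rw [← hm, ← hc, Finset.sum_apply, map_sum]
      refine Finset.sum_congr rfl fun j _ => ?_
      rw [Pi.smul_apply, Pi.smul_apply, smul_eq_mul, smul_eq_mul]
      by_cases hj : vdeg a (v j) < a i
      · rw [hzero _ _ hj, mul_zero, mul_zero, map_zero]
      · have hlf : (lfVec a (v j) i).IsHomogeneous (vdeg a (v j) - a i) :=
          homogeneousComponent_isHomogeneous _ _
        rw [homogeneousComponent_mul_of_isHomogeneous hlf, ite_mul, zero_mul]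
        have hsub : vdeg a m - a i - (vdeg a (v j) - a i) = vdeg a m - vdeg a (v j) := by omega
        rw [hsub]
        exact if_congr (by omega) rfl rfl

open MvPolynomial in
theorem homogVec_mem_span_of_lfVec_mem_span {ι : Type*} [Fintype ι] (a : Fin n → ℕ)
    (v : ι → Fin n → MvPolynomial (Fin d) 𝕜)
    (h : ∀ m ∈ Submodule.span (MvPolynomial (Fin d) 𝕜) (Set.range v), m ≠ 0 →
      lfVec a m ∈ Submodule.span (MvPolynomial (Fin d) 𝕜) (Set.range fun j => lfVec a (v j)))
    (m : Fin n → MvPolynomial (Fin d) 𝕜)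
    (hm : m ∈ Submodule.span (MvPolynomial (Fin d) 𝕜) (Set.range v)) (hm0 : m ≠ 0) :
    homogVec a m ∈ Submodule.span (MvPolynomial (Fin (d + 1)) 𝕜)
      (Set.range fun j => homogVec a (v j)) := by
  induction hD : vdeg a m using Nat.strong_induction_on generalizing m with
  | _ D ih =>
    obtain ⟨c, hc⟩ := (Submodule.mem_span_range_iff_exists_fun _).mp (h m hm hm0)
    obtain ⟨b, hb, hb0, hsum⟩ := exists_homogeneous_coeff_of_lfVec_eq_sum a hc
    rw [hD] at hb hb0
    have hbv : ∀ j, homogVecAt a D (b j • v j) =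
        rename Fin.castSucc (b j) • homogVec a (v j) := by
      intro j
      rw [homogVecAt_smul a (hb j)]
      by_cases hj : D < vdeg a (v j)
      · rw [hb0 j hj, map_zero, zero_smul, zero_smul]
      · rw [homogVec_eq_homogVecAt, Nat.sub_sub_self (by omega)]
    have hmD : homogVec a m = homogVecAt a D m := hD ▸ homogVec_eq_homogVecAt a m
    set m' := m - ∑ j, b j • v j with hm'
    have hdecomp : homogVec a m =
        ∑ j, rename Fin.castSucc (b j) • homogVec a (v j) + homogVecAt a D m' := by
      rw [hm', map_sub, map_sum, hmD]
      simp only [hbv]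
      abel
    have hm'mem : m' ∈ Submodule.span (MvPolynomial (Fin d) 𝕜) (Set.range v) :=
      Submodule.sub_mem _ hm (Submodule.sum_mem _ fun j _ =>
        Submodule.smul_mem _ _ (Submodule.subset_span ⟨j, rfl⟩))
    rw [hdecomp]
    refine Submodule.add_mem _ (Submodule.sum_mem _ fun j _ =>
        Submodule.smul_mem _ _ (Submodule.subset_span ⟨j, rfl⟩)) ?_
    by_cases hm'0 : m' = 0
    · rw [hm'0, map_zero]
      exact Submodule.zero_mem _
    · have hlt : vdeg a m' < D := by
        refine vdeg_lt_of_evalLastZero_homogVecAt_eq_zero a hm'0 fun i => ?_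
        have hi := congrArg evalLastZero (congrFun hdecomp i)
        have hsi := congrFun hsum i
        simp only [Pi.add_apply, Finset.sum_apply, Pi.smul_apply, smul_eq_mul, map_add, map_sum,
          map_mul, evalLastZero_rename, evalLastZero_homogVec] at hi hsi
        rw [hsi] at hi
        exact left_eq_add.mp hi
      rw [← X_pow_smul_homogVec a m' hlt.le]
      exact Submodule.smul_mem _ _ (ih _ hlt m' hm'mem hm'0 rfl)

theorem lfVec_mem_span_of_homogVec_mem_span {ι : Type*} [Fintype ι] (a : Fin n → ℕ)
    (v : ι → Fin n → MvPolynomial (Fin d) 𝕜) {m : Fin n → MvPolynomial (Fin d) 𝕜}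
    (h : homogVec a m ∈ Submodule.span (MvPolynomial (Fin (d + 1)) 𝕜)
      (Set.range fun j => homogVec a (v j))) :
    lfVec a m ∈ Submodule.span (MvPolynomial (Fin d) 𝕜)
      (Set.range fun j => lfVec a (v j)) := by
  obtain ⟨c, hc⟩ := (Submodule.mem_span_range_iff_exists_fun _).mp h
  refine (Submodule.mem_span_range_iff_exists_fun _).mpr ⟨fun j => evalLastZero (c j), ?_⟩
  funext i
  have hi := congrArg evalLastZero (congrFun hc i)
  simpa only [Finset.sum_apply, Pi.smul_apply, smul_eq_mul, map_sum, map_mul,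
    evalLastZero_homogVec] using hi

/-- for nonzero `v_1, …, v_s` generating the `T`-submodule
`M ≤ T^{⊕n}`, the homogenization `M^H` is generated by `v_1^H, …, v_s^H` iff
`v_1, …, v_s` is a Macaulay `H`-basis of `M`. -/
theorem homogenization_iff_macaulayHBasis (a : Fin n → ℕ) {s : ℕ}
    (v : Fin s → (Fin n → MvPolynomial (Fin d) 𝕜)) (hv : ∀ j, v j ≠ 0) :
    (Submodule.span (MvPolynomial (Fin (d + 1)) 𝕜)
        {y : Fin n → MvPolynomial (Fin (d + 1)) 𝕜 |
          ∃ m ∈ Submodule.span (MvPolynomial (Fin d) 𝕜) (Set.range v),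
            m ≠ 0 ∧ y = homogVec a m} =
      Submodule.span (MvPolynomial (Fin (d + 1)) 𝕜)
        (Set.range fun j => homogVec a (v j))) ↔
    (Submodule.span (MvPolynomial (Fin d) 𝕜)
        {y : Fin n → MvPolynomial (Fin d) 𝕜 |
          ∃ m ∈ Submodule.span (MvPolynomial (Fin d) 𝕜) (Set.range v),
            m ≠ 0 ∧ y = lfVec a m} =
      Submodule.span (MvPolynomial (Fin d) 𝕜)
        (Set.range fun j => lfVec a (v j))) := by
  have hvM : ∀ j, v j ∈ Submodule.span (MvPolynomial (Fin d) 𝕜) (Set.range v) :=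
    fun j => Submodule.subset_span ⟨j, rfl⟩
  constructor
  · intro h
    refine le_antisymm (Submodule.span_le.mpr ?_) (Submodule.span_mono ?_)
    · rintro _ ⟨m, hm, hm0, rfl⟩
      exact lfVec_mem_span_of_homogVec_mem_span a v
        (h ▸ Submodule.subset_span ⟨m, hm, hm0, rfl⟩)
    · rintro _ ⟨j, rfl⟩
      exact ⟨v j, hvM j, hv j, rfl⟩
  · intro h
    refine le_antisymm (Submodule.span_le.mpr ?_) (Submodule.span_mono ?_)
    · rintro _ ⟨m, hm, hm0, rfl⟩
      exact homogVec_mem_span_of_lfVec_mem_span a v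
        (fun m hm hm0 => h ▸ Submodule.subset_span ⟨m, hm, hm0, rfl⟩) m hm hm0
    · rintro _ ⟨j, rfl⟩
      exact ⟨v j, hvM j, hv j, rfl⟩

end
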